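/- arXiv:2011.12539 — 5 statements merged into one kernel-verified Lean document; each statement's English description precedes it below -/
import Mathlib

section
/- Under Assumptions 1 and 2 (α-strong convexity of f(·;θ), and h-Lipschitzness of ∇_x f(x;·) in the parameter), the total cost C satisfies the following strong-convexity-type inequality with inexact gradients: for any x, y ∈ X^T, any true parameter θ ∈ Θ^T, and any inexact parameter θ' ∈ Θ^T, C(y; θ) ≥ C(x; θ) + ⟨∇_x C(x; θ'), y − x⟩ + (α/4) ||x − y||² − (h²/α) ||θ' − θ||². -/
open Finset
open scoped RealInnerProductSpace

noncomputable section

/-- The total SOCO cost `C(x; θ) = ∑_{t=1}^T [f(x_t; θ_t) + d(x_t, x_{t-1})]`,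
where the initial point is `x 0`. -/
def socoCost {n p : ℕ} (T : ℕ)
    (f : EuclideanSpace ℝ (Fin n) → EuclideanSpace ℝ (Fin p) → ℝ)
    (d : EuclideanSpace ℝ (Fin n) → EuclideanSpace ℝ (Fin n) → ℝ)
    (θ : ℕ → EuclideanSpace ℝ (Fin p)) (x : ℕ → EuclideanSpace ℝ (Fin n)) : ℝ :=
  ∑ t ∈ Finset.Icc 1 T, (f (x t) (θ t) + d (x t) (x (t - 1)))

/-- The partial gradient of the total cost with respect to `x_t`:
`∇_{x_t} C(x;θ) = ∇_{x_t} f(x_t;θ_t) + ∇_{x_t} d(x_t,x_{t-1}) + ∇_{x_t} d(x_{t+1},x_t)·1_{t ≤ T-1}`,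
where `Gf` is the gradient of `f` in its first argument and `Gd1`, `Gd2` are the partial
gradients of `d` in its first and second arguments. -/
def socoGrad {n p : ℕ} (T : ℕ)
    (Gf : EuclideanSpace ℝ (Fin n) → EuclideanSpace ℝ (Fin p) → EuclideanSpace ℝ (Fin n))
    (Gd1 Gd2 : EuclideanSpace ℝ (Fin n) → EuclideanSpace ℝ (Fin n) → EuclideanSpace ℝ (Fin n))
    (θ : ℕ → EuclideanSpace ℝ (Fin p)) (x : ℕ → EuclideanSpace ℝ (Fin n)) (t : ℕ) :
    EuclideanSpace ℝ (Fin n) :=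
  Gf (x t) (θ t) + Gd1 (x t) (x (t - 1)) + (if t < T then Gd2 (x (t + 1)) (x t) else 0)

/-- Reindexing a sum truncated below its last index as a sum of predecessors, for a sequence
that vanishes at `0`. -/
lemma sum_Icc_ite_lt_eq_sum_pred {M : Type*} [AddCommMonoid M] (T : ℕ) (a : ℕ → M)
    (h0 : a 0 = 0) :
    ∑ t ∈ Finset.Icc 1 T, (if t < T then a t else 0) = ∑ t ∈ Finset.Icc 1 T, a (t - 1) := by
  cases T with
  | zero => simp
  | succ k =>
    rw [← Finset.Ico_add_one_right_eq_Icc, Finset.sum_Ico_eq_sum_range,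
      Finset.sum_Ico_eq_sum_range]
    simp only [Nat.add_sub_cancel, Nat.add_sub_cancel_left]
    rw [Finset.sum_range_succ, Finset.sum_range_succ']
    simp only [h0, add_zero, add_comm 1 k, lt_irrefl, if_false]
    refine Finset.sum_congr rfl fun t ht => ?_
    rw [Finset.mem_range] at ht
    rw [if_pos (by omega), add_comm]

/-- Young's inequality for the inner product of a vector of norm at most `c` with `v`. -/
lemma inner_le_of_norm_le {E : Type*} [NormedAddCommGroup E] [InnerProductSpace ℝ E]
    {α c : ℝ} (hα : 0 < α) {u v : E} (hu : ‖u‖ ≤ c) :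
    ⟪u, v⟫ ≤ α / 4 * ‖v‖ ^ 2 + c ^ 2 / α := by
  have hcs : ⟪u, v⟫ ≤ c * ‖v‖ :=
    (real_inner_le_norm u v).trans (mul_le_mul_of_nonneg_right hu (norm_nonneg v))
  have hsq : α / 4 * ‖v‖ ^ 2 + c ^ 2 / α - c * ‖v‖ = (α * ‖v‖ - 2 * c) ^ 2 / (4 * α) := by
    field_simp
    ring
  have hnn : 0 ≤ (α * ‖v‖ - 2 * c) ^ 2 / (4 * α) := by positivity
  linarith

/-- The inner product of the total gradient with a displacement, regrouped so that each
switching cost contributes both of its partial gradients at the same time step. -/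
lemma sum_inner_socoGrad {n p : ℕ} (T : ℕ)
    (Gf : EuclideanSpace ℝ (Fin n) → EuclideanSpace ℝ (Fin p) → EuclideanSpace ℝ (Fin n))
    (Gd1 Gd2 : EuclideanSpace ℝ (Fin n) → EuclideanSpace ℝ (Fin n) → EuclideanSpace ℝ (Fin n))
    (θ : ℕ → EuclideanSpace ℝ (Fin p)) (x y : ℕ → EuclideanSpace ℝ (Fin n)) (h0 : y 0 = x 0) :
    ∑ t ∈ Finset.Icc 1 T, ⟪socoGrad T Gf Gd1 Gd2 θ x t, y t - x t⟫
      = ∑ t ∈ Finset.Icc 1 T, (⟪Gf (x t) (θ t), y t - x t⟫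
          + ⟪Gd1 (x t) (x (t - 1)), y t - x t⟫
          + ⟪Gd2 (x t) (x (t - 1)), y (t - 1) - x (t - 1)⟫) := by
  have hshift := sum_Icc_ite_lt_eq_sum_pred T
    (fun t => ⟪Gd2 (x (t + 1)) (x t), y t - x t⟫) (by simp [h0])
  have hpred : ∑ t ∈ Finset.Icc 1 T, ⟪Gd2 (x (t - 1 + 1)) (x (t - 1)), y (t - 1) - x (t - 1)⟫
      = ∑ t ∈ Finset.Icc 1 T, ⟪Gd2 (x t) (x (t - 1)), y (t - 1) - x (t - 1)⟫ :=
    Finset.sum_congr rfl fun t ht => by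
      rw [Nat.sub_add_cancel (Finset.mem_Icc.mp ht).1]
  rw [Finset.sum_add_distrib, ← hpred, ← hshift, ← Finset.sum_add_distrib]
  refine Finset.sum_congr rfl fun t _ => ?_
  rw [socoGrad, inner_add_left, inner_add_left]
  split_ifs <;> simp

/-- **Lemma 4: strong convexity inequality with gradient errors.** Under
Assumptions 1 and 2, for any `x, y ∈ X^T`, any true parameter `θ ∈ Θ^T` and any inexact
parameter `θ' ∈ Θ^T`,
`C(y;θ) ≥ C(x;θ) + ⟨∇_x C(x;θ'), y − x⟩ + (α/4)‖x − y‖² − (h²/α)‖θ' − θ‖²`. -/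
theorem stmt3 {n p : ℕ} (T : ℕ) (hT : 1 ≤ T)
    (X : Set (EuclideanSpace ℝ (Fin n))) (Θ : Set (EuclideanSpace ℝ (Fin p)))
    (hXne : X.Nonempty) (hXcl : IsClosed X) (hXcv : Convex ℝ X)
    (x₀ : EuclideanSpace ℝ (Fin n)) (hx₀ : x₀ ∈ X)
    (f : EuclideanSpace ℝ (Fin n) → EuclideanSpace ℝ (Fin p) → ℝ)
    (d : EuclideanSpace ℝ (Fin n) → EuclideanSpace ℝ (Fin n) → ℝ)
    (Gf : EuclideanSpace ℝ (Fin n) → EuclideanSpace ℝ (Fin p) → EuclideanSpace ℝ (Fin n))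
    (Gd1 Gd2 : EuclideanSpace ℝ (Fin n) → EuclideanSpace ℝ (Fin n) → EuclideanSpace ℝ (Fin n))
    (α lf ld h : ℝ) (hα : 0 < α) (hlf : 0 ≤ lf) (hld : 0 ≤ ld)
    -- Assumption 1: `f(·;θ)` is `α`-strongly convex on `X` for every `θ ∈ Θ`
    (hfsc : ∀ θ ∈ Θ, ∀ x ∈ X, ∀ y ∈ X,
      f y θ ≥ f x θ + ⟪Gf x θ, y - x⟫ + α / 2 * ‖y - x‖ ^ 2)
    -- Assumption 1: `f(·;θ)` is `l_f`-smooth on `X` for every `θ ∈ Θ`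
    (hfsm : ∀ θ ∈ Θ, ∀ x ∈ X, ∀ y ∈ X, ‖Gf x θ - Gf y θ‖ ≤ lf * ‖x - y‖)
    -- Assumption 1: `d` is jointly convex on `X × X`
    (hdcv : ∀ a ∈ X, ∀ b ∈ X, ∀ a' ∈ X, ∀ b' ∈ X,
      d a' b' ≥ d a b + ⟪Gd1 a b, a' - a⟫ + ⟪Gd2 a b, b' - b⟫)
    -- Assumption 1: `d` is `l_d`-smooth on `X × X` (Euclidean norm on the product)
    (hdsm : ∀ a ∈ X, ∀ b ∈ X, ∀ a' ∈ X, ∀ b' ∈ X,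
      ‖Gd1 a b - Gd1 a' b'‖ ^ 2 + ‖Gd2 a b - Gd2 a' b'‖ ^ 2
        ≤ ld ^ 2 * (‖a - a'‖ ^ 2 + ‖b - b'‖ ^ 2))
    -- Assumption 2: `∇_x f(x;·)` is `h`-Lipschitz in the parameter
    (hlip : ∀ x ∈ X, ∀ θ ∈ Θ, ∀ θ' ∈ Θ, ‖Gf x θ - Gf x θ'‖ ≤ h * ‖θ - θ'‖)
    :
    ∀ θ θ' : ℕ → EuclideanSpace ℝ (Fin p),
      (∀ t ∈ Finset.Icc 1 T, θ t ∈ Θ) → (∀ t ∈ Finset.Icc 1 T, θ' t ∈ Θ) →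
      ∀ x y : ℕ → EuclideanSpace ℝ (Fin n),
        x 0 = x₀ → (∀ t ∈ Finset.Icc 1 T, x t ∈ X) →
        y 0 = x₀ → (∀ t ∈ Finset.Icc 1 T, y t ∈ X) →
        socoCost T f d θ y ≥ socoCost T f d θ x
          + ∑ t ∈ Finset.Icc 1 T, ⟪socoGrad T Gf Gd1 Gd2 θ' x t, y t - x t⟫
          + α / 4 * ∑ t ∈ Finset.Icc 1 T, ‖x t - y t‖ ^ 2
          - h ^ 2 / α * ∑ t ∈ Finset.Icc 1 T, ‖θ' t - θ t‖ ^ 2 := by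
  intro θ θ' hθ hθ' x y hx0 hx hy0 hy
  have hpred : ∀ z : ℕ → EuclideanSpace ℝ (Fin n), z 0 = x₀ →
      (∀ t ∈ Finset.Icc 1 T, z t ∈ X) → ∀ t ∈ Finset.Icc 1 T, z (t - 1) ∈ X := by
    intro z hz0 hz t ht
    rw [Finset.mem_Icc] at ht
    rcases Nat.eq_zero_or_pos (t - 1) with h1 | h1
    · rw [h1, hz0]
      exact hx₀
    · exact hz _ (Finset.mem_Icc.mpr ⟨h1, by omega⟩)
  rw [sum_inner_socoGrad T Gf Gd1 Gd2 θ' x y (hy0.trans hx0.symm), socoCost, socoCost,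
    Finset.mul_sum, Finset.mul_sum, ← Finset.sum_add_distrib, ← Finset.sum_add_distrib,
    ← Finset.sum_sub_distrib]
  refine Finset.sum_le_sum fun t ht => ?_
  have hf := hfsc _ (hθ t ht) _ (hx t ht) _ (hy t ht)
  have hd := hdcv _ (hx t ht) _ (hpred x hx0 hx t ht) _ (hy t ht) _ (hpred y hy0 hy t ht)
  have hg := inner_le_of_norm_le (v := y t - x t) hα
    (hlip _ (hx t ht) _ (hθ' t ht) _ (hθ t ht))
  rw [inner_sub_left, mul_pow, mul_div_right_comm] at hg
  rw [norm_sub_rev (x t) (y t)]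
  linarith
end
end

section
/- (Static regret of online gradient descent with inexact gradients.) Let X ⊆ ℝ^n be nonempty, closed and convex, let θ_1,…,θ_T ∈ Θ be true parameters and ε_1,…,ε_T ∈ ℝ^p parameter errors with θ_t − ε_t ∈ Θ. Suppose f(·;θ) is α-strongly convex on X for every θ ∈ Θ, ||∇_x f(x;θ)|| ≤ G for all x ∈ X and θ ∈ Θ, and ||∇_x f(x;θ) − ∇_x f(x;θ')|| ≤ h||θ − θ'||. Define iterates x_1 ∈ X arbitrary and x_{t+1} = Π_X[x_t − ξ_{t+1} ∇_x f(x_t; θ_t − ε_t)] for t ≥ 1 with stepsizes ξ_t = 4/(α t). Then for z* = argmin_{z ∈ X} Σ_{t=1}^T f(z; θ_t), the static regret satisfies Σ_{t=1}^T [f(x_t; θ_t) − f(z*; θ_t)] ≤ (2G²/α) log(T + 1) + (h²/α) Σ_{t=1}^T ||ε_t||². -/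
open Finset
open scoped RealInnerProductSpace

noncomputable section

/-- A nearest point `q` of a convex set `K` to `u` is at least as close to every point of `K`
as `u` is. -/
lemma norm_sub_le_of_forall_norm_sub_le {E : Type*} [NormedAddCommGroup E]
    [InnerProductSpace ℝ E] {K : Set E} (hK : Convex ℝ K) {u q z : E} (hq : q ∈ K)
    (hmin : ∀ y ∈ K, ‖q - u‖ ≤ ‖y - u‖) (hz : z ∈ K) : ‖q - z‖ ≤ ‖u - z‖ := by
  have hinf : ‖u - q‖ = ⨅ w : K, ‖u - w‖ := by
    have : Nonempty K := ⟨⟨q, hq⟩⟩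
    refine le_antisymm (le_ciInf fun w => ?_)
      (ciInf_le ⟨0, by rintro _ ⟨w, rfl⟩; exact norm_nonneg _⟩ (⟨q, hq⟩ : K))
    simpa only [norm_sub_rev] using hmin w w.2
  have hvar := (norm_eq_iInf_iff_real_inner_le_zero hK hq).1 hinf z hz
  have hsq := norm_sub_sq_real (u - q) (z - q)
  rw [sub_sub_sub_cancel_right, norm_sub_rev z q] at hsq
  refine (sq_le_sq₀ (norm_nonneg _) (norm_nonneg _)).1 ?_
  nlinarith [sq_nonneg ‖u - q‖]

/-- One projected gradient step of size `ξ` with direction `g`. -/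
lemma inner_le_of_norm_sub_le_gradient_step {E : Type*} [NormedAddCommGroup E]
    [InnerProductSpace ℝ E] {x x' z g : E} {ξ : ℝ} (hξ : 0 < ξ)
    (hx' : ‖x' - z‖ ≤ ‖x - ξ • g - z‖) :
    ⟪g, x - z⟫ ≤ (‖x - z‖ ^ 2 - ‖x' - z‖ ^ 2) / (2 * ξ) + ξ / 2 * ‖g‖ ^ 2 := by
  have hsq := norm_sub_sq_real (x - z) (ξ • g)
  rw [sub_right_comm, inner_smul_right, real_inner_comm, norm_smul, mul_pow, Real.norm_eq_abs,
    sq_abs] at hsq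
  have hle : ‖x' - z‖ ^ 2 ≤ ‖x - ξ • g - z‖ ^ 2 := by gcongr
  rw [← sub_le_iff_le_add, le_div_iff₀ (by positivity)]
  linarith

/-- Regret of a single round for an `α`-strongly convex loss, when the gradient is replaced
by an inexact one. -/
lemma strongConvex_gap_le_inexact_inner {E : Type*} [NormedAddCommGroup E]
    [InnerProductSpace ℝ E] {x z g g' : E} {a b α δ : ℝ} (hα : 0 < α)
    (hsc : b ≥ a + ⟪g, z - x⟫ + α / 2 * ‖z - x‖ ^ 2) (hδ : ‖g - g'‖ ≤ δ) :
    a - b ≤ ⟪g', x - z⟫ + δ ^ 2 / α - α / 4 * ‖x - z‖ ^ 2 := by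
  have hcs : ⟪g - g', x - z⟫ ≤ δ * ‖x - z‖ :=
    (real_inner_le_norm _ _).trans (by gcongr)
  have hyoung : δ * ‖x - z‖ ≤ δ ^ 2 / α + α / 4 * ‖x - z‖ ^ 2 := by
    have hnonneg : 0 ≤ (δ - α / 2 * ‖x - z‖) ^ 2 / α := by positivity
    have heq : (δ - α / 2 * ‖x - z‖) ^ 2 / α
        = δ ^ 2 / α + α / 4 * ‖x - z‖ ^ 2 - δ * ‖x - z‖ := by
      field_simp
      ring
    linarith
  rw [inner_sub_left] at hcs
  rw [← neg_sub x z, inner_neg_right, norm_neg] at hsc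
  linarith

/-- The increment of `log` dominates the corresponding term of the harmonic series. -/
lemma one_div_add_one_le_log_sub_log {y : ℝ} (hy : 0 < y) :
    1 / (y + 1) ≤ Real.log (y + 1) - Real.log y := by
  rw [← Real.log_div (by positivity) hy.ne']
  refine le_trans (le_of_eq ?_) (Real.one_sub_inv_le_log_of_pos (by positivity))
  field_simp
  ring

/-- Telescoping of the regret recursion, where `D t` stands for the squared distance of the
iterate at time `t` to the comparator. -/
lemma sum_regret_le_of_recursion {T : ℕ} {α C : ℝ} {r e D : ℕ → ℝ} (hα : 0 < α) (hC : 0 ≤ C)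
    (hD : ∀ t, 0 ≤ D t)
    (hstep : ∀ t, 1 ≤ t → t ≤ T →
      r t ≤ α * (t + 1) / 8 * (D t - D (t + 1)) + C * (1 / (t + 1)) + e t - α / 4 * D t) :
    ∑ t ∈ Finset.Icc 1 T, r t ≤ C * Real.log (T + 1) + ∑ t ∈ Finset.Icc 1 T, e t := by
  have key : ∀ m, m ≤ T → ∑ t ∈ Finset.Icc 1 m, r t
      ≤ C * Real.log (m + 1) + ∑ t ∈ Finset.Icc 1 m, e t - α * m / 8 * D (m + 1) := by
    intro m
    induction m with
    | zero => simp
    | succ m ih =>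
      intro hm
      have hprev := ih (by omega)
      have hr := hstep (m + 1) (by omega) hm
      have hlog := mul_le_mul_of_nonneg_left
        (one_div_add_one_le_log_sub_log (y := (m : ℝ) + 1) (by positivity)) hC
      rw [Finset.sum_Icc_succ_top (by omega), Finset.sum_Icc_succ_top (by omega)]
      push_cast at hr ⊢
      nlinarith [mul_nonneg hα.le (hD (m + 1 + 1))]
  have hDT : 0 ≤ α * T / 8 * D (T + 1) := mul_nonneg (by positivity) (hD _)
  linarith [key T le_rfl]

/-- **static regret of online gradient descent with inexact gradients.**
Let `X ⊆ ℝ^n` be nonempty, closed and convex, let `θ_1,…,θ_T ∈ Θ` be true parameters and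
`ε_1,…,ε_T` parameter errors with `θ_t − ε_t ∈ Θ`. Suppose `f(·;θ)` is `α`-strongly convex on
`X` for every `θ ∈ Θ` (with gradient map `Gf`), `‖∇_x f(x;θ)‖ ≤ G` on `X × Θ`, and
`‖∇_x f(x;θ) − ∇_x f(x;θ')‖ ≤ h‖θ − θ'‖`. Define iterates `x_1 ∈ X` arbitrary and
`x_{t+1} = Π_X[x_t − ξ_{t+1} ∇_x f(x_t; θ_t − ε_t)]` with stepsizes `ξ_t = 4/(α t)`.
Then for `z* = argmin_{z ∈ X} ∑_{t=1}^T f(z;θ_t)`,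
`∑_{t=1}^T [f(x_t;θ_t) − f(z*;θ_t)] ≤ (2G²/α) log(T+1) + (h²/α) ∑_{t=1}^T ‖ε_t‖²`. -/
theorem stmt8 {n p : ℕ} (T : ℕ) (hT : 1 ≤ T)
    (X : Set (EuclideanSpace ℝ (Fin n))) (Θ : Set (EuclideanSpace ℝ (Fin p)))
    (hXne : X.Nonempty) (hXcl : IsClosed X) (hXcv : Convex ℝ X)
    (f : EuclideanSpace ℝ (Fin n) → EuclideanSpace ℝ (Fin p) → ℝ)
    (Gf : EuclideanSpace ℝ (Fin n) → EuclideanSpace ℝ (Fin p) → EuclideanSpace ℝ (Fin n))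
    (α G h : ℝ) (hα : 0 < α)
    -- `f(·;θ)` is `α`-strongly convex on `X` for every `θ ∈ Θ`
    (hfsc : ∀ θ ∈ Θ, ∀ x ∈ X, ∀ y ∈ X,
      f y θ ≥ f x θ + ⟪Gf x θ, y - x⟫ + α / 2 * ‖y - x‖ ^ 2)
    -- uniform gradient bound
    (hG : ∀ x ∈ X, ∀ θ ∈ Θ, ‖Gf x θ‖ ≤ G)
    -- the gradient is `h`-Lipschitz in the parameter
    (hlip : ∀ x ∈ X, ∀ θ ∈ Θ, ∀ θ' ∈ Θ, ‖Gf x θ - Gf x θ'‖ ≤ h * ‖θ - θ'‖)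
    -- true parameters and parameter errors
    (θ ε : ℕ → EuclideanSpace ℝ (Fin p))
    (hθ : ∀ t ∈ Finset.Icc 1 T, θ t ∈ Θ)
    (hε : ∀ t ∈ Finset.Icc 1 T, θ t - ε t ∈ Θ)
    -- the OGD iterates with inexact gradients and stepsizes `ξ_t = 4/(α t)`
    (x : ℕ → EuclideanSpace ℝ (Fin n)) (hx1 : x 1 ∈ X)
    (hiter : ∀ t, 1 ≤ t → t < T →
      x (t + 1) ∈ X ∧ ∀ y ∈ X,
        ‖x (t + 1) - (x t - (4 / (α * (t + 1))) • Gf (x t) (θ t - ε t))‖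
          ≤ ‖y - (x t - (4 / (α * (t + 1))) • Gf (x t) (θ t - ε t))‖)
    -- `z* = argmin_{z ∈ X} ∑_{t=1}^T f(z;θ_t)`
    (zstar : EuclideanSpace ℝ (Fin n)) (hzstar : zstar ∈ X)
    (hzopt : ∀ z ∈ X,
      ∑ t ∈ Finset.Icc 1 T, f zstar (θ t) ≤ ∑ t ∈ Finset.Icc 1 T, f z (θ t)) :
    ∑ t ∈ Finset.Icc 1 T, (f (x t) (θ t) - f zstar (θ t))
      ≤ 2 * G ^ 2 / α * Real.log (T + 1)
        + h ^ 2 / α * ∑ t ∈ Finset.Icc 1 T, ‖ε t‖ ^ 2 := by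
  have hxX : ∀ t, 1 ≤ t → t ≤ T → x t ∈ X := by
    intro t ht
    induction t, ht using Nat.le_induction with
    | base => exact fun _ => hx1
    | succ t ht _ => exact fun hlt => (hiter t ht hlt).1
  -- past the horizon no iterate is prescribed, so the distance is replaced by zero
  let D : ℕ → ℝ := fun t => if t ≤ T then ‖x t - zstar‖ ^ 2 else 0
  have hD : ∀ t, 0 ≤ D t := fun t => by
    dsimp only [D]
    split_ifs <;> positivity
  have hstep : ∀ t, 1 ≤ t → t ≤ T →
      f (x t) (θ t) - f zstar (θ t)
        ≤ α * (t + 1) / 8 * (D t - D (t + 1)) + 2 * G ^ 2 / α * (1 / (t + 1))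
          + h ^ 2 / α * ‖ε t‖ ^ 2 - α / 4 * D t := by
    intro t ht htT
    have htmem : t ∈ Finset.Icc 1 T := Finset.mem_Icc.2 ⟨ht, htT⟩
    have hxt := hxX t ht htT
    have herr : ‖Gf (x t) (θ t) - Gf (x t) (θ t - ε t)‖ ≤ h * ‖ε t‖ := by
      simpa using hlip _ hxt _ (hθ t htmem) _ (hε t htmem)
    have hgap := strongConvex_gap_le_inexact_inner hα
      (hfsc _ (hθ t htmem) _ hxt _ hzstar) herr
    obtain ⟨x', hx', hDx'⟩ : ∃ x', ‖x' - zstar‖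
        ≤ ‖x t - (4 / (α * (t + 1))) • Gf (x t) (θ t - ε t) - zstar‖ ∧
          D (t + 1) = ‖x' - zstar‖ ^ 2 := by
      rcases htT.lt_or_eq with hlt | rfl
      · obtain ⟨hmem, hmin⟩ := hiter t ht hlt
        exact ⟨x (t + 1), norm_sub_le_of_forall_norm_sub_le hXcv hmem hmin hzstar,
          if_pos hlt⟩
      · exact ⟨zstar, by simp, by simp [D]⟩
    have hinner := inner_le_of_norm_sub_le_gradient_step (by positivity) hx'
    have hDt : D t = ‖x t - zstar‖ ^ 2 := if_pos htT
    have hGsq : ‖Gf (x t) (θ t - ε t)‖ ^ 2 ≤ G ^ 2 := by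
      gcongr
      exact hG _ hxt _ (hε t htmem)
    rw [← hDt, ← hDx'] at hinner
    rw [← hDt, mul_pow, mul_div_right_comm] at hgap
    have hgrad : 4 / (α * (t + 1)) / 2 * ‖Gf (x t) (θ t - ε t)‖ ^ 2
        ≤ 2 * G ^ 2 / α * (1 / (t + 1)) :=
      calc _ ≤ 4 / (α * (t + 1)) / 2 * G ^ 2 := by gcongr
        _ = _ := by
          field_simp
          ring
    have hdist : (D t - D (t + 1)) / (2 * (4 / (α * (t + 1))))
        = α * (t + 1) / 8 * (D t - D (t + 1)) := by
      field_simp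
      ring
    linarith
  rw [Finset.mul_sum]
  exact sum_regret_le_of_recursion hα (by positivity) hD hstep
end
end

section
/- Let 0 < α ≤ 4L, h > 0, ρ = 1 − α/(4L) and ζ = h²/α + h²/(2L). Let (a_k)_{k=1}^T be a nondecreasing sequence of nonnegative reals (a_k representing ||δ(k)||², with a_j := a_T for j > T). Define PartII(W) = (2Lh²/α²) ρ^W a_{min(W,T)} + Σ_{k=1}^{min(W,T)} ζ ρ^{k−1} a_k + 1_{(W>T)} (ρ^T − ρ^W)/(1−ρ) ζ a_T for integers W ≥ 1. Then PartII(W) − PartII(W−1) ≥ (h²/(2α) + h²/(2L)) ρ^{W−1} a_{min(W−1,T)} ≥ 0 for every W ≥ 2; in particular PartII is monotonically nondecreasing in W. -/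
noncomputable section

/-- `Part II` of the RHIG regret bound of Corollary 1:
`PartII(W) = c ρ^W a_{min(W,T)} + ∑_{k=1}^{min(W,T)} ζ ρ^{k−1} a_k
  + 1_{W>T} (ρ^T − ρ^W)/(1−ρ) ζ a_T`, where `c = 2Lh²/α²`. -/
def partII (ρ ζ c : ℝ) (T : ℕ) (a : ℕ → ℝ) (W : ℕ) : ℝ :=
  c * ρ ^ W * a (min W T)
    + ∑ k ∈ Finset.Icc 1 (min W T), ζ * ρ ^ (k - 1) * a k
    + (if T < W then (ρ ^ T - ρ ^ W) / (1 - ρ) * ζ * a T else 0)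

/-- One-step increment of `partII`. -/
theorem partII_succ (ρ ζ c : ℝ) (hρ : ρ ≠ 1) (T : ℕ) (a : ℕ → ℝ) (n : ℕ) :
    partII ρ ζ c T a (n + 1) = partII ρ ζ c T a n
      + (c * ρ ^ (n + 1) * a (min (n + 1) T) - c * ρ ^ n * a (min n T)
        + ζ * ρ ^ n * a (min (n + 1) T)) := by
  have h1 : 1 - ρ ≠ 0 := sub_ne_zero.mpr hρ.symm
  unfold partII
  rcases lt_or_ge n T with hn | hn
  · rw [min_eq_left hn.le, min_eq_left (Nat.succ_le_of_lt hn), if_neg (by omega),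
      if_neg (by omega), Finset.sum_Icc_succ_top (by omega), Nat.add_sub_cancel]
    ring
  · have hif : (if T < n then (ρ ^ T - ρ ^ n) / (1 - ρ) * ζ * a T else 0)
        = (ρ ^ T - ρ ^ n) / (1 - ρ) * ζ * a T := by
      rcases hn.eq_or_lt with rfl | hlt
      · simp
      · rw [if_pos hlt]
    rw [min_eq_right hn, min_eq_right (by omega), hif, if_pos (by omega)]
    field_simp
    ring

/-- A sequence that is nondecreasing on `[1, T]` stays so when its index is capped at `T`. -/
theorem capped_le_capped_succ {T : ℕ} (hT : 1 ≤ T) {a : ℕ → ℝ}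
    (hamono : ∀ j k, 1 ≤ j → j ≤ k → k ≤ T → a j ≤ a k) {n : ℕ} (hn : 1 ≤ n) :
    a (min n T) ≤ a (min (n + 1) T) :=
  hamono _ _ (by omega) (by omega) (by omega)

/-- **monotonicity of Part II of the regret bound of Corollary 1.** Let
`0 < α ≤ 4L`, `h > 0`, `ρ = 1 − α/(4L)`, `ζ = h²/α + h²/(2L)`, and let `(a_k)_{k=1}^T` be a
nondecreasing sequence of nonnegative reals (`a_k` representing `‖δ(k)‖²`, with `a_j := a_T`
for `j > T`). Then, with `c = 2Lh²/α²`,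
`PartII(W) − PartII(W−1) ≥ (h²/(2α) + h²/(2L)) ρ^{W−1} a_{min(W−1,T)} ≥ 0` for every `W ≥ 2`;
in particular `PartII` is monotonically nondecreasing in `W`. -/
theorem stmt13 (α L h : ℝ) (hα : 0 < α) (hαL : α ≤ 4 * L) (hh : 0 < h)
    (ρ ζ : ℝ) (hρ : ρ = 1 - α / (4 * L)) (hζ : ζ = h ^ 2 / α + h ^ 2 / (2 * L))
    (T : ℕ) (hT : 1 ≤ T) (a : ℕ → ℝ)
    (ha0 : ∀ k, 0 ≤ a k)
    (hamono : ∀ j k, 1 ≤ j → j ≤ k → k ≤ T → a j ≤ a k)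
    (haext : ∀ j, T < j → a j = a T) :
    (∀ W : ℕ, 2 ≤ W →
      partII ρ ζ (2 * L * h ^ 2 / α ^ 2) T a W - partII ρ ζ (2 * L * h ^ 2 / α ^ 2) T a (W - 1)
          ≥ (h ^ 2 / (2 * α) + h ^ 2 / (2 * L)) * ρ ^ (W - 1) * a (min (W - 1) T)
        ∧ 0 ≤ (h ^ 2 / (2 * α) + h ^ 2 / (2 * L)) * ρ ^ (W - 1) * a (min (W - 1) T))
    ∧ ∀ W W' : ℕ, 1 ≤ W → W ≤ W' →
        partII ρ ζ (2 * L * h ^ 2 / α ^ 2) T a W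
          ≤ partII ρ ζ (2 * L * h ^ 2 / α ^ 2) T a W' := by
  have hL : 0 < L := by linarith
  have hρ0 : 0 ≤ ρ := by
    rw [hρ, sub_nonneg, div_le_one (by linarith)]
    exact hαL
  have hρ1 : ρ ≠ 1 := by
    have : 0 < α / (4 * L) := by positivity
    linarith
  have hc : 0 ≤ 2 * L * h ^ 2 / α ^ 2 := by positivity
  have hgap : 2 * L * h ^ 2 / α ^ 2 * ρ - 2 * L * h ^ 2 / α ^ 2 + ζ
      = h ^ 2 / (2 * α) + h ^ 2 / (2 * L) := by
    rw [hρ, hζ]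
    field_simp
    ring
  have hζ0 : 0 ≤ ζ := by rw [hζ]; positivity
  have hnonneg (n : ℕ) :
      0 ≤ (h ^ 2 / (2 * α) + h ^ 2 / (2 * L)) * ρ ^ n * a (min n T) := by
    have := ha0 (min n T)
    positivity
  have hstep (n : ℕ) (hn : 1 ≤ n) :
      (h ^ 2 / (2 * α) + h ^ 2 / (2 * L)) * ρ ^ n * a (min n T)
        ≤ partII ρ ζ (2 * L * h ^ 2 / α ^ 2) T a (n + 1)
          - partII ρ ζ (2 * L * h ^ 2 / α ^ 2) T a n := by
    rw [partII_succ ρ ζ _ hρ1, ← hgap]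
    generalize 2 * L * h ^ 2 / α ^ 2 = c at hc
    have hcoef : 0 ≤ (c * ρ + ζ) * ρ ^ n := by positivity
    have := mul_le_mul_of_nonneg_left (capped_le_capped_succ hT hamono hn) hcoef
    rw [pow_succ]
    linarith
  refine ⟨fun W hW => ?_, fun W W' hW hWW' => ?_⟩
  · obtain ⟨n, rfl⟩ : ∃ n, W = n + 1 := ⟨W - 1, by omega⟩
    rw [Nat.add_sub_cancel]
    exact ⟨hstep n (by omega), hnonneg n⟩
  · induction W', hWW' using Nat.le_induction with
    | base => exact le_rfl
    | succ n hn ih => linarith [hstep n (hW.trans hn), hnonneg n]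
end
end

section
/- (Corollary 2.) Let 0 < α ≤ 4L, h, G, β, C₁ > 0, ρ = 1 − α/(4L), ζ = h²/α + h²/(2L), and let (a_k)_{k=1}^T be a nondecreasing sequence of nonnegative reals (a_k = ||δ(k)||², with a_j := a_T for j > T). Define the Corollary-1 regret bound R(W) = ρ^W (2L/α) C₁ √(V_T T) log(1 + √(T/V_T)) + (2L/α)(h²/α) ρ^W a_{min(W,T)} + Σ_{k=1}^{min(W,T)} ζ ρ^{k−1} a_k + 1_{(W>T)} (ρ^T − ρ^W)/(1−ρ) ζ a_T. If √(V_T T) log(1 + √(T/V_T)) ≥ [(2L h² ρ + α² ζ)/(2L C₁ (1−ρ) α)] a_T, then R(W) ≤ R(W−1) for all integers W ≥ 1, so R is minimized as W → +∞, and lim_{W→+∞} R(W) = Σ_{k=1}^T ζ ρ^{k−1} a_k + (ρ^T/(1−ρ)) ζ a_T ≤ (ζ/(1−ρ)) Σ_{k=1}^T ρ^{k−1} a_k. -/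
noncomputable section

/-- The Corollary-1 regret bound of RHIG with restarted-OGD initialization and lookahead `W`:
`R(W) = ρ^W (2L/α) C₁ √(V_T T) log(1 + √(T/V_T)) + (2L/α)(h²/α) ρ^W a_{min(W,T)}
  + ∑_{k=1}^{min(W,T)} ζ ρ^{k−1} a_k + 1_{W>T} (ρ^T − ρ^W)/(1−ρ) ζ a_T`,
with `ρ = 1 − α/(4L)` and `ζ = h²/α + h²/(2L)`. -/
def regBound (α L h C₁ VT : ℝ) (T : ℕ) (a : ℕ → ℝ) (W : ℕ) : ℝ :=
  (1 - α / (4 * L)) ^ W * (2 * L / α) * C₁ * Real.sqrt (VT * T)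
      * Real.log (1 + Real.sqrt (T / VT))
    + (2 * L / α) * (h ^ 2 / α) * (1 - α / (4 * L)) ^ W * a (min W T)
    + ∑ k ∈ Finset.Icc 1 (min W T),
        (h ^ 2 / α + h ^ 2 / (2 * L)) * (1 - α / (4 * L)) ^ (k - 1) * a k
    + (if T < W then
        ((1 - α / (4 * L)) ^ T - (1 - α / (4 * L)) ^ W) / (1 - (1 - α / (4 * L)))
          * (h ^ 2 / α + h ^ 2 / (2 * L)) * a T
      else 0)

/-- The increment of the regret bound when the lookahead grows by one step. -/
theorem regBound_succ_sub {α L : ℝ} (hρ : α / (4 * L) ≠ 0) (h C₁ VT : ℝ) (T : ℕ) (a : ℕ → ℝ)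
    (W : ℕ) :
    regBound α L h C₁ VT T a (W + 1) - regBound α L h C₁ VT T a W
      = (1 - α / (4 * L)) ^ W *
        (-(α / (4 * L)) * (2 * L / α * C₁ * (√(VT * T) * Real.log (1 + √(T / VT))))
          + 2 * L / α * (h ^ 2 / α)
            * ((1 - α / (4 * L)) * a (min (W + 1) T) - a (min W T))
          + (h ^ 2 / α + h ^ 2 / (2 * L)) * a (min (W + 1) T)) := by
  unfold regBound
  generalize α / (4 * L) = q at *
  rw [sub_sub_cancel]
  rcases lt_or_ge W T with hW | hW
  · rw [min_eq_left hW.le, min_eq_left (Nat.succ_le_of_lt hW), if_neg (by lia),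
      if_neg (by lia), Finset.sum_Icc_succ_top (by lia), Nat.add_sub_cancel]
    ring
  · have htail : (if T < W then ((1 - q) ^ T - (1 - q) ^ W) / q
          * (h ^ 2 / α + h ^ 2 / (2 * L)) * a T else 0)
        = ((1 - q) ^ T - (1 - q) ^ W) / q * (h ^ 2 / α + h ^ 2 / (2 * L)) * a T := by
      split_ifs with hlt
      · rfl
      · rw [le_antisymm (not_lt.1 hlt) hW]
        simp
    have hdiv : ((1 - q) ^ T - (1 - q) ^ (W + 1)) / q
        = ((1 - q) ^ T - (1 - q) ^ W) / q + (1 - q) ^ W := by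
      field_simp
      ring
    rw [htail, min_eq_right hW, min_eq_right (by lia : T ≤ W + 1), if_pos (by lia), hdiv]
    ring

/-- The regret bound converges as the lookahead tends to infinity. -/
theorem tendsto_regBound {α L : ℝ} (hρ0 : 0 ≤ 1 - α / (4 * L)) (hρ1 : 1 - α / (4 * L) < 1)
    (h C₁ VT : ℝ) (T : ℕ) (a : ℕ → ℝ) :
    Filter.Tendsto (fun W : ℕ => regBound α L h C₁ VT T a W) Filter.atTop
      (nhds (∑ k ∈ Finset.Icc 1 T,
          (h ^ 2 / α + h ^ 2 / (2 * L)) * (1 - α / (4 * L)) ^ (k - 1) * a k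
        + (1 - α / (4 * L)) ^ T / (1 - (1 - α / (4 * L)))
          * (h ^ 2 / α + h ^ 2 / (2 * L)) * a T)) := by
  have hpow := tendsto_pow_atTop_nhds_zero_of_lt_one hρ0 hρ1
  have hlim :=
    ((((hpow.mul_const (2 * L / α)).mul_const C₁).mul_const √(VT * T)).mul_const
        (Real.log (1 + √(T / VT)))).add
      ((hpow.const_mul (2 * L / α * (h ^ 2 / α))).mul_const (a T))
    |>.add_const (∑ k ∈ Finset.Icc 1 T,
        (h ^ 2 / α + h ^ 2 / (2 * L)) * (1 - α / (4 * L)) ^ (k - 1) * a k)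
    |>.add ((((hpow.const_sub ((1 - α / (4 * L)) ^ T)).div_const
        (1 - (1 - α / (4 * L)))).mul_const (h ^ 2 / α + h ^ 2 / (2 * L))).mul_const (a T))
  simp only [zero_mul, mul_zero, zero_add, sub_zero] at hlim
  refine hlim.congr' ?_
  filter_upwards [Filter.eventually_gt_atTop T] with W hW
  rw [regBound, min_eq_right hW.le, if_pos hW]

/-- A weighted sum whose last weight is repeated geometrically is at most `1 / (1 - ρ)` times the
weighted sum. -/
theorem sum_add_geometric_tail_le {ρ ζ : ℝ} (hρ0 : 0 ≤ ρ) (hρ1 : ρ < 1) (hζ : 0 ≤ ζ)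
    {T : ℕ} (hT : 1 ≤ T) {a : ℕ → ℝ} (ha : ∀ k, 0 ≤ a k) :
    ∑ k ∈ Finset.Icc 1 T, ζ * ρ ^ (k - 1) * a k + ρ ^ T / (1 - ρ) * ζ * a T
      ≤ ζ / (1 - ρ) * ∑ k ∈ Finset.Icc 1 T, ρ ^ (k - 1) * a k := by
  have hlast : ρ ^ (T - 1) * a T ≤ ∑ k ∈ Finset.Icc 1 T, ρ ^ (k - 1) * a k :=
    Finset.single_le_sum (f := fun k => ρ ^ (k - 1) * a k)
      (fun k _ => mul_nonneg (pow_nonneg hρ0 _) (ha k)) (Finset.mem_Icc.2 ⟨hT, le_rfl⟩)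
  have hpos : 0 < 1 - ρ := sub_pos.2 hρ1
  have hpow : ρ ^ T = ρ * ρ ^ (T - 1) := (mul_pow_sub_one (by lia) ρ).symm
  simp_rw [mul_assoc ζ]
  rw [← Finset.mul_sum, hpow]
  generalize ∑ k ∈ Finset.Icc 1 T, ρ ^ (k - 1) * a k = S at hlast ⊢
  calc ζ * S + ρ * ρ ^ (T - 1) / (1 - ρ) * ζ * a T
      = ζ * S + ζ * ρ / (1 - ρ) * (ρ ^ (T - 1) * a T) := by ring
    _ ≤ ζ * S + ζ * ρ / (1 - ρ) * S := by gcongr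
    _ = ζ / (1 - ρ) * S := by
      field_simp
      ring

/-- **Corollary 2.** Let `0 < α ≤ 4L`, `h, G, β > 0`,
`C₁ = 4√2 G²/α + 32√2 β G²/α² + 20 > 0`, `ρ = 1 − α/(4L)`, `ζ = h²/α + h²/(2L)`, and let
`(a_k)_{k=1}^T` be a nondecreasing sequence of nonnegative reals (`a_k = ‖δ(k)‖²`, with
`a_j := a_T` for `j > T`). If
`√(V_T T) log(1 + √(T/V_T)) ≥ [(2L h² ρ + α² ζ)/(2L C₁ (1−ρ) α)] a_T`,
then the Corollary-1 regret bound satisfies `R(W) ≤ R(W−1)` for all integers `W ≥ 1`, so `R`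
is minimized as `W → +∞`, and
`lim_{W→∞} R(W) = ∑_{k=1}^T ζ ρ^{k−1} a_k + (ρ^T/(1−ρ)) ζ a_T ≤ (ζ/(1−ρ)) ∑_{k=1}^T ρ^{k−1} a_k`. -/
theorem stmt14 (α L h G β C₁ : ℝ) (hα : 0 < α) (hαL : α ≤ 4 * L)
    (hh : 0 < h) (hG : 0 < G) (hβ : 0 < β)
    (hC₁ : C₁ = 4 * Real.sqrt 2 * G ^ 2 / α + 32 * Real.sqrt 2 * β * G ^ 2 / α ^ 2 + 20)
    (ρ ζ : ℝ) (hρ : ρ = 1 - α / (4 * L)) (hζ : ζ = h ^ 2 / α + h ^ 2 / (2 * L))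
    (T : ℕ) (hT : 1 ≤ T) (VT : ℝ) (hVT1 : 1 ≤ VT) (hVT2 : VT ≤ (T : ℝ))
    (a : ℕ → ℝ)
    (ha0 : ∀ k, 0 ≤ a k)
    (hamono : ∀ j k, 1 ≤ j → j ≤ k → k ≤ T → a j ≤ a k)
    (haext : ∀ j, T < j → a j = a T)
    -- the condition of Corollary 2: `V_T` is large compared to the prediction errors
    (hcond : Real.sqrt (VT * T) * Real.log (1 + Real.sqrt (T / VT))
      ≥ (2 * L * h ^ 2 * ρ + α ^ 2 * ζ) / (2 * L * C₁ * (1 - ρ) * α) * a T) :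
    (∀ W : ℕ, 1 ≤ W → regBound α L h C₁ VT T a W ≤ regBound α L h C₁ VT T a (W - 1))
    ∧ Filter.Tendsto (fun W : ℕ => regBound α L h C₁ VT T a W) Filter.atTop
        (nhds (∑ k ∈ Finset.Icc 1 T, ζ * ρ ^ (k - 1) * a k + ρ ^ T / (1 - ρ) * ζ * a T))
    ∧ ∑ k ∈ Finset.Icc 1 T, ζ * ρ ^ (k - 1) * a k + ρ ^ T / (1 - ρ) * ζ * a T
        ≤ ζ / (1 - ρ) * ∑ k ∈ Finset.Icc 1 T, ρ ^ (k - 1) * a k := by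
  have hL : 0 < L := by linarith
  have hρ0 : 0 ≤ ρ := by
    rw [hρ, sub_nonneg, div_le_one (by positivity)]
    exact hαL
  have hq : 0 < α / (4 * L) := by positivity
  have hρ1 : ρ < 1 := by linarith
  have hζ0 : 0 ≤ ζ := by rw [hζ]; positivity
  have hC : 0 < C₁ := by rw [hC₁]; positivity
  refine ⟨fun W hW => ?_, ?_, sum_add_geometric_tail_le hρ0 hρ1 hζ0 hT ha0⟩
  · obtain ⟨W, rfl⟩ := Nat.exists_eq_add_of_le' hW
    rw [Nat.add_sub_cancel, ← sub_nonpos, regBound_succ_sub hq.ne', ← hζ, ← hρ,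
      show α / (4 * L) = 1 - ρ by linarith]
    refine mul_nonpos_of_nonneg_of_nonpos (pow_nonneg hρ0 W) ?_
    have haT : a (min (W + 1) T) ≤ a T := hamono _ _ (by lia) (min_le_right _ _) le_rfl
    have hpos : 0 < 1 - ρ := sub_pos.2 hρ1
    set S := √(VT * T) * Real.log (1 + √(T / VT))
    have hS : (2 * L / α * (h ^ 2 / α) * ρ + ζ) * a T ≤ (1 - ρ) * (2 * L / α * C₁ * S) := by
      calc (2 * L / α * (h ^ 2 / α) * ρ + ζ) * a T
          = (1 - ρ) * (2 * L / α * C₁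
            * ((2 * L * h ^ 2 * ρ + α ^ 2 * ζ) / (2 * L * C₁ * (1 - ρ) * α) * a T)) := by
            field_simp
        _ ≤ (1 - ρ) * (2 * L / α * C₁ * S) := by gcongr
    have hB : 0 ≤ 2 * L / α * (h ^ 2 / α) := by positivity
    have hmono := mul_le_mul_of_nonneg_left haT (add_nonneg (mul_nonneg hB hρ0) hζ0)
    have hprev := mul_nonneg hB (ha0 (min W T))
    linarith
  · rw [hρ] at hρ0 hρ1
    rw [hζ, hρ]
    exact tendsto_regBound hρ0 hρ1 h C₁ VT T a
end
end

section
/- Let P(0),…,P(T−1) ∈ ℝ^{p×q} be matrices, R_e ∈ ℝ^{q×q} a positive semidefinite matrix, and let M_k ∈ ℝ^{pT×qT} (for 1 ≤ k ≤ T) be the block banded lower-triangular matrix whose (t,s) block equals P(t−s) when 0 ≤ t−s ≤ k−1 and is zero otherwise, and let 𝐑_e = diag(R_e,…,R_e) ∈ ℝ^{qT×qT}. Fix constants α, L, h > 0 with α ≤ 4L, and set ρ = 1 − α/(4L), ζ = h²/α + h²/(2L). For any integer 1 ≤ W ≤ T, the symmetric matrix A_W = ρ^W (2Lh²/α²) 𝐑_e^{1/2}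 M_Wᵀ M_W 𝐑_e^{1/2} + ζ Σ_{k=1}^W ρ^{k−1} 𝐑_e^{1/2} M_kᵀ M_k 𝐑_e^{1/2} satisfies ||A_W||_F ≤ ζ Σ_{t=0}^{W−1} ||R_e||₂ (T − t) ||P(t)||_F² · ρ^t/(1−ρ). -/
open Finset Matrix

noncomputable section

/-- The block banded lower-triangular matrix `M_k ∈ ℝ^{pT×qT}` whose `(t,s)` block equals
`P(t−s)` when `0 ≤ t−s ≤ k−1` and is zero otherwise. -/
def blockM (T p q : ℕ) (P : ℕ → Matrix (Fin p) (Fin q) ℝ) (k : ℕ) :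
    Matrix (Fin T × Fin p) (Fin T × Fin q) ℝ :=
  fun ti sj =>
    if sj.1.1 ≤ ti.1.1 ∧ ti.1.1 - sj.1.1 ≤ k - 1 then P (ti.1.1 - sj.1.1) ti.2 sj.2 else 0

/-- The block-diagonal matrix `𝐑_e = diag(R_e, …, R_e) ∈ ℝ^{qT×qT}`. -/
def blockRe (T q : ℕ) (Re : Matrix (Fin q) (Fin q) ℝ) :
    Matrix (Fin T × Fin q) (Fin T × Fin q) ℝ :=
  fun ti sj => if ti.1 = sj.1 then Re ti.2 sj.2 else 0

/-- The Frobenius norm of a matrix. -/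
def frobNorm {m n : Type*} [Fintype m] [Fintype n] (A : Matrix m n ℝ) : ℝ :=
  Real.sqrt (∑ i, ∑ j, (A i j) ^ 2)

theorem frobNorm_add_le {m n : Type*} [Fintype m] [Fintype n] (A B : Matrix m n ℝ) :
    frobNorm (A + B) ≤ frobNorm A + frobNorm B := by
  let := Matrix.frobeniusNormedAddCommGroup (m := m) (n := n) (α := ℝ)
  have key (C : Matrix m n ℝ) : frobNorm C = ‖C‖ := by
    simp [frobNorm, Matrix.frobenius_norm_def, Real.sqrt_eq_rpow]
  simpa only [key] using norm_add_le A B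

theorem frobNorm_mul_le {l m n : Type*} [Fintype l] [Fintype m] [Fintype n]
    (A : Matrix l m ℝ) (B : Matrix m n ℝ) :
    frobNorm (A * B) ≤ frobNorm A * frobNorm B := by
  have h := Matrix.frobenius_norm_mul A B
  simpa [frobNorm, Matrix.frobenius_norm_def, Real.sqrt_eq_rpow] using h

theorem frobNorm_smul {m n : Type*} [Fintype m] [Fintype n] {c : ℝ} (hc : 0 ≤ c)
    (A : Matrix m n ℝ) : frobNorm (c • A) = c * frobNorm A := by
  simp only [frobNorm, Matrix.smul_apply, smul_eq_mul, mul_pow, ← Finset.mul_sum]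
  rw [Real.sqrt_mul (sq_nonneg c), Real.sqrt_sq hc]

theorem frobNorm_transpose {m n : Type*} [Fintype m] [Fintype n] (A : Matrix m n ℝ) :
    frobNorm Aᵀ = frobNorm A := by
  simp only [frobNorm, Matrix.transpose_apply]
  rw [Finset.sum_comm]

theorem frobNorm_sum_le {ι m n : Type*} [Fintype m] [Fintype n] (s : Finset ι)
    (f : ι → Matrix m n ℝ) : frobNorm (∑ k ∈ s, f k) ≤ ∑ k ∈ s, frobNorm (f k) :=
  Finset.le_sum_of_subadditive frobNorm (by simp [frobNorm]) frobNorm_add_le s f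

theorem frobNorm_transpose_mul_self_le {m n : Type*} [Fintype m] [Fintype n]
    (A : Matrix m n ℝ) : frobNorm (Aᵀ * A) ≤ ∑ i, ∑ j, A i j ^ 2 := by
  refine (frobNorm_mul_le _ _).trans_eq ?_
  rw [frobNorm_transpose, frobNorm, Real.mul_self_sqrt]
  positivity

theorem dotProduct_mulVec_le_norm_mul {n : Type*} [Fintype n] [DecidableEq n]
    (A : Matrix n n ℝ) (v : n → ℝ) :
    v ⬝ᵥ A *ᵥ v ≤ ‖Matrix.toEuclideanCLM (𝕜 := ℝ) A‖ * ∑ j, v j ^ 2 := by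
  have h1 := real_inner_le_norm (WithLp.toLp 2 v)
    (Matrix.toEuclideanCLM (𝕜 := ℝ) A (WithLp.toLp 2 v))
  have h2 := (Matrix.toEuclideanCLM (𝕜 := ℝ) A).le_opNorm (WithLp.toLp 2 v)
  have h3 : ‖WithLp.toLp 2 v‖ ^ 2 = ∑ j, v j ^ 2 := by
    simp [EuclideanSpace.norm_sq_eq]
  have h4 : inner ℝ (WithLp.toLp 2 v) (Matrix.toEuclideanCLM (𝕜 := ℝ) A (WithLp.toLp 2 v))
      = v ⬝ᵥ A *ᵥ v := by
    simp [EuclideanSpace.inner_eq_star_dotProduct, dotProduct_comm]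
  rw [← h4, ← h3]
  nlinarith [norm_nonneg (WithLp.toLp 2 v)]

theorem dotProduct_blockRe_mulVec_le (T q : ℕ) (Re : Matrix (Fin q) (Fin q) ℝ)
    (v : Fin T × Fin q → ℝ) :
    v ⬝ᵥ blockRe T q Re *ᵥ v ≤ ‖Matrix.toEuclideanCLM (𝕜 := ℝ) Re‖ * ∑ x, v x ^ 2 := by
  have h : v ⬝ᵥ blockRe T q Re *ᵥ v
      = ∑ s, (fun j => v (s, j)) ⬝ᵥ Re *ᵥ (fun j => v (s, j)) := by
    simp only [dotProduct, Matrix.mulVec, blockRe, Fintype.sum_prod_type, ite_mul, zero_mul]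
    refine Finset.sum_congr rfl fun s _ => Finset.sum_congr rfl fun j _ => ?_
    congr 1
    rw [Finset.sum_comm]
    simp
  rw [h, Fintype.sum_prod_type, Finset.mul_sum]
  exact Finset.sum_le_sum fun s _ => dotProduct_mulVec_le_norm_mul Re _

theorem sum_sq_mul_sqrt_le {m : Type*} [Fintype m] (T q : ℕ) (Re : Matrix (Fin q) (Fin q) ℝ)
    (S : Matrix (Fin T × Fin q) (Fin T × Fin q) ℝ) (hS : Sᵀ = S)
    (hSsq : S * S = blockRe T q Re) (M : Matrix m (Fin T × Fin q) ℝ) :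
    ∑ i, ∑ j, (M * S) i j ^ 2
      ≤ ‖Matrix.toEuclideanCLM (𝕜 := ℝ) Re‖ * ∑ i, ∑ j, M i j ^ 2 := by
  rw [Finset.mul_sum]
  refine Finset.sum_le_sum fun i _ => ?_
  refine le_trans (le_of_eq ?_) (dotProduct_blockRe_mulVec_le T q Re (M i))
  have h : ∑ j, (M * S) i j ^ 2 = (M i ᵥ* S) ⬝ᵥ (S *ᵥ M i) := by
    have h' : S *ᵥ M i = M i ᵥ* S := by
      rw [← Matrix.vecMul_transpose, hS]
    rw [h']
    simp [dotProduct, sq, Matrix.mul_apply_eq_vecMul]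
  rw [h, ← hSsq, ← Matrix.mulVec_mulVec, Matrix.dotProduct_mulVec (M i)]

theorem sum_range_band (T k : ℕ) (hk : 1 ≤ k) (g : ℕ → ℝ) :
    ∑ t ∈ range T, ∑ s ∈ range T, (if s ≤ t ∧ t - s ≤ k - 1 then g (t - s) else 0)
      = ∑ u ∈ range k, ((T - u : ℕ) : ℝ) * g u := by
  have h1 (t s : ℕ) : (if s ≤ t ∧ t - s ≤ k - 1 then g (t - s) else 0)
      = ∑ u ∈ range k, if t = s + u then g u else 0 := by
    split_ifs with h
    · rw [Finset.sum_eq_single_of_mem (t - s) (by rw [mem_range]; omega)]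
      · rw [if_pos (by omega)]
      · intro u _ hu
        rw [if_neg (by omega)]
    · refine (Finset.sum_eq_zero fun u hu => ?_).symm
      rw [mem_range] at hu
      rw [if_neg (by omega)]
  simp only [h1]
  rw [Finset.sum_comm]
  simp only [Finset.sum_comm (s := range T) (t := range k)]
  refine Finset.sum_congr rfl fun u _ => ?_
  simp only [Finset.sum_ite_eq', mem_range]
  rw [← Finset.sum_filter, Finset.sum_const, nsmul_eq_mul]
  have h2 : (range T).filter (fun s => s + u < T) = range (T - u) := by
    ext s
    simp only [mem_filter, mem_range]
    omega
  rw [h2, card_range]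

theorem sum_sq_blockM (T p q : ℕ) (P : ℕ → Matrix (Fin p) (Fin q) ℝ) (k : ℕ) (hk : 1 ≤ k) :
    ∑ x, ∑ y, blockM T p q P k x y ^ 2
      = ∑ u ∈ range k, ((T - u : ℕ) : ℝ) * ∑ i, ∑ j, P u i j ^ 2 := by
  rw [← sum_range_band T k hk fun u => ∑ i, ∑ j, P u i j ^ 2, ← Fin.sum_univ_eq_sum_range
    (fun t => ∑ s ∈ range T, if s ≤ t ∧ t - s ≤ k - 1 then ∑ i, ∑ j, P (t - s) i j ^ 2 else 0)]
  rw [Fintype.sum_prod_type]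
  refine Finset.sum_congr rfl fun t _ => ?_
  rw [← Fin.sum_univ_eq_sum_range
    (fun s => if s ≤ t.1 ∧ t.1 - s ≤ k - 1 then ∑ i, ∑ j, P (t.1 - s) i j ^ 2 else 0)]
  simp only [Fintype.sum_prod_type]
  rw [Finset.sum_comm]
  refine Finset.sum_congr rfl fun s _ => ?_
  simp only [blockM]
  split_ifs <;> simp

theorem sum_Icc_geom_mul_sum_range (ρ : ℝ) (hρ : ρ ≠ 1) (a : ℕ → ℝ) (W : ℕ) :
    ∑ k ∈ Icc 1 W, ρ ^ (k - 1) * ∑ t ∈ range k, a t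
      = ∑ t ∈ range W, a t * ((ρ ^ t - ρ ^ W) / (1 - ρ)) := by
  have h : 1 - ρ ≠ 0 := sub_ne_zero.mpr hρ.symm
  induction W with
  | zero => simp
  | succ n ih =>
    rw [Finset.sum_Icc_succ_top (by omega), ih, Finset.sum_range_succ (n := n),
      Finset.sum_range_succ (n := n), Nat.add_sub_cancel, mul_add, ← add_assoc, Finset.mul_sum,
      ← Finset.sum_add_distrib]
    congr 1
    · refine Finset.sum_congr rfl fun t _ => ?_
      field_simp
      ring
    · field_simp
      ring

/-- Let `P(0),…,P(T−1) ∈ ℝ^{p×q}`, let `R_e` be positive semidefinite, let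
`M_k` be the block banded lower-triangular matrices above and `𝐑_e = diag(R_e,…,R_e)`. Fix
`α, L, h > 0` with `α ≤ 4L` and set `ρ = 1 − α/(4L)`, `ζ = h²/α + h²/(2L)`. For any integer
`1 ≤ W ≤ T` and any positive semidefinite square root `S = 𝐑_e^{1/2}` of `𝐑_e`, the symmetric
matrix `A_W = ρ^W (2Lh²/α²) S M_Wᵀ M_W S + ζ ∑_{k=1}^W ρ^{k−1} S M_kᵀ M_k S` satisfies
`‖A_W‖_F ≤ ζ ∑_{t=0}^{W−1} ‖R_e‖₂ (T − t) ‖P(t)‖_F² ρ^t/(1−ρ)`, where `‖·‖₂` is the spectral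
norm. -/
theorem stmt19 (T p q : ℕ) (hT : 1 ≤ T)
    (P : ℕ → Matrix (Fin p) (Fin q) ℝ)
    (Re : Matrix (Fin q) (Fin q) ℝ) (hRe : Re.PosSemidef)
    (α L h : ℝ) (hα : 0 < α) (hL : 0 < L) (hh : 0 < h) (hαL : α ≤ 4 * L)
    (ρ ζ : ℝ) (hρ : ρ = 1 - α / (4 * L)) (hζ : ζ = h ^ 2 / α + h ^ 2 / (2 * L))
    (W : ℕ) (hW1 : 1 ≤ W) (hWT : W ≤ T)
    (S : Matrix (Fin T × Fin q) (Fin T × Fin q) ℝ)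
    (hS : S.PosSemidef) (hSsq : S * S = blockRe T q Re) :
    frobNorm
        ((ρ ^ W * (2 * L * h ^ 2 / α ^ 2)) •
            (S * (blockM T p q P W)ᵀ * blockM T p q P W * S)
          + ∑ k ∈ Finset.Icc 1 W,
              (ζ * ρ ^ (k - 1)) • (S * (blockM T p q P k)ᵀ * blockM T p q P k * S))
      ≤ ζ * ∑ t ∈ Finset.range W,
          ‖Matrix.toEuclideanCLM (𝕜 := ℝ) Re‖ * ((T - t : ℕ) : ℝ)
            * (∑ i, ∑ j, (P t i j) ^ 2) * (ρ ^ t / (1 - ρ)) := by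
  have hST : Sᵀ = S := by simpa using hS.1.eq
  have h4L : 0 < α / (4 * L) := by positivity
  have hρ0 : 0 ≤ ρ := by
    have : α / (4 * L) ≤ 1 := (div_le_one (by positivity)).mpr hαL
    linarith
  have hρ1 : 0 < 1 - ρ := by linarith
  have hζ0 : 0 ≤ ζ := by rw [hζ]; positivity
  set r := ‖Matrix.toEuclideanCLM (𝕜 := ℝ) Re‖
  set a : ℕ → ℝ := fun t => ((T - t : ℕ) : ℝ) * ∑ i, ∑ j, P t i j ^ 2 with ha
  have ha0 (t : ℕ) : 0 ≤ a t := by positivity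
  have hblock (k : ℕ) (hk : 1 ≤ k) :
      frobNorm (S * (blockM T p q P k)ᵀ * blockM T p q P k * S) ≤ r * ∑ t ∈ range k, a t := by
    have h1 : S * (blockM T p q P k)ᵀ * blockM T p q P k * S
        = (blockM T p q P k * S)ᵀ * (blockM T p q P k * S) := by
      rw [Matrix.transpose_mul, hST]
      simp only [Matrix.mul_assoc]
    rw [h1, ← sum_sq_blockM T p q P k hk]
    exact (frobNorm_transpose_mul_self_le _).trans (sum_sq_mul_sqrt_le T q Re S hST hSsq _)
  have hcoef : 2 * L * h ^ 2 / α ^ 2 ≤ ζ / (1 - ρ) := by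
    have : ζ / (1 - ρ) = 2 * L * h ^ 2 / α ^ 2 + (2 * L * h ^ 2 / α ^ 2 + 2 * h ^ 2 / α) := by
      rw [hζ, show 1 - ρ = α / (4 * L) by rw [hρ]; ring]
      field_simp
      ring
    rw [this]
    have : 0 ≤ 2 * L * h ^ 2 / α ^ 2 + 2 * h ^ 2 / α := by positivity
    linarith
  calc _ ≤ ρ ^ W * (2 * L * h ^ 2 / α ^ 2) * (r * ∑ t ∈ range W, a t)
        + ∑ k ∈ Icc 1 W, ζ * ρ ^ (k - 1) * (r * ∑ t ∈ range k, a t) := by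
        refine (frobNorm_add_le _ _).trans (add_le_add ?_ ?_)
        · rw [frobNorm_smul (by positivity)]
          exact mul_le_mul_of_nonneg_left (hblock W hW1) (by positivity)
        · refine (frobNorm_sum_le _ _).trans (Finset.sum_le_sum fun k hk => ?_)
          rw [frobNorm_smul (by positivity)]
          exact mul_le_mul_of_nonneg_left (hblock k (mem_Icc.mp hk).1) (by positivity)
    _ ≤ ρ ^ W * (ζ / (1 - ρ)) * (r * ∑ t ∈ range W, a t)
        + ζ * r * ∑ k ∈ Icc 1 W, ρ ^ (k - 1) * ∑ t ∈ range k, a t := by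
        refine add_le_add ?_ (le_of_eq ?_)
        · have hsum : 0 ≤ r * ∑ t ∈ range W, a t :=
            mul_nonneg (norm_nonneg _) (Finset.sum_nonneg fun t _ => ha0 t)
          gcongr
        · rw [Finset.mul_sum]
          exact Finset.sum_congr rfl fun k _ => by ring
    _ = _ := by
        rw [sum_Icc_geom_mul_sum_range ρ (by linarith)]
        simp only [Finset.mul_sum]
        rw [← Finset.sum_add_distrib]
        refine Finset.sum_congr rfl fun t _ => ?_
        simp only [ha, ← Finset.mul_sum]
        field_simp
        ring
end
end
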